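/- arXiv:1208.4827 — 6 statements merged into one kernel-verified Lean document; each statement's English description precedes it below -/
import Mathlib

section
/- Let L0 be a closed, densely defined, symmetric, positive definite operator in a complex Hilbert space H (re⟪L0 y, y⟫ ≥ κ‖y‖², κ > 0), K := Ker L0*, P the orthogonal projection of H onto K and P⊥ := I − P. Let L be a self-adjoint extension of L0 satisfying re⟪L y, y⟫ ≥ κ‖y‖² which is bijective from Dom L onto H, with everywhere-defined bounded inverse L⁻¹. Then for every y ∈ Dom L0*, setting y0 := L⁻¹(P⊥(L0* y)), g := P(L0* y), h := y − L⁻¹(L0* y), one has: y0 ∈ Dom L0, g ∈ K, h ∈ K, and y = y0 + L⁻¹ g + h (existence part of the Vishik decomposition Dom L0* = Dom L0 ∔ L⁻¹K ∔ K with explicit formulas). -/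
local notation "⟪" x ", " y "⟫" => @inner ℂ _ _ x y

/-- The kernel of a partially defined linear operator, as a submodule of the ambient space. -/
def pker {H : Type*} [NormedAddCommGroup H] [InnerProductSpace ℂ H]
    (T : H →ₗ.[ℂ] H) : Submodule ℂ H :=
  (LinearMap.ker T.toFun).map T.domain.subtype

/-- A vector orthogonal to the range of a densely defined operator lies in the kernel of its
adjoint. -/
theorem mem_pker_adjoint_of_inner_eq_zero {H : Type*} [NormedAddCommGroup H]
    [InnerProductSpace ℂ H] [CompleteSpace H] {T : H →ₗ.[ℂ] H}
    (hT : Dense (T.domain : Set H)) {v : H} (hv : ∀ u : T.domain, ⟪v, T u⟫ = 0) :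
    v ∈ pker T.adjoint := by
  have h : ∀ u : T.domain, ⟪(0 : H), (u : H)⟫ = ⟪v, T u⟫ := fun u => by
    rw [hv u, inner_zero_left]
  have hmem : v ∈ T.adjoint.domain := T.mem_adjoint_domain_of_exists v ⟨0, h⟩
  exact ⟨⟨v, hmem⟩, LinearPMap.adjoint_apply_eq hT ⟨v, hmem⟩ h, rfl⟩

/-- If a closed densely defined operator `T` has a bounded left inverse `S`, then `S` maps the
orthogonal complement of `Ker T*` into the domain of `T`. -/
theorem leftInverse_mem_domain_of_mem_pker_adjoint_orthogonal {H : Type*} [NormedAddCommGroup H]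
    [InnerProductSpace ℂ H] [CompleteSpace H] {T : H →ₗ.[ℂ] H}
    (hT : Dense (T.domain : Set H)) (hclosed : T.IsClosed) {S : H →L[ℂ] H}
    (hS : ∀ u : T.domain, S (T u) = u) {x : H} (hx : x ∈ (pker T.adjoint)ᗮ) :
    S x ∈ T.domain := by
  let R : Submodule ℂ H := T.graph.comap (S.prod (ContinuousLinearMap.id ℂ H)).toLinearMap
  have hR : IsClosed (R : Set H) :=
    IsClosed.preimage (S.prod (ContinuousLinearMap.id ℂ H)).continuous hclosed
  have hrange : ∀ u : T.domain, T u ∈ R := fun u => by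
    change (S (T u), T u) ∈ T.graph
    rw [hS u]
    exact T.mem_graph u
  have hker : Rᗮ ≤ pker T.adjoint := fun v hv =>
    mem_pker_adjoint_of_inner_eq_zero hT fun u =>
      Submodule.inner_left_of_mem_orthogonal (hrange u) hv
  have hxR : x ∈ R := by
    have hmem : x ∈ Rᗮᗮ := Submodule.orthogonal_le hker hx
    rwa [Submodule.orthogonal_orthogonal_eq_closure, hR.submodule_topologicalClosure_eq] at hmem
  exact LinearPMap.mem_domain_of_mem_graph (show (S x, x) ∈ T.graph from hxR)

/-- Existence part of the Vishik decomposition `Dom L0* = Dom L0 ∔ L⁻¹K ∔ K`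
with the explicit formulas `y0 = L⁻¹ P⊥ L0* y`, `g = P L0* y`, `h = y - L⁻¹ L0* y`. -/
theorem statement1 {H : Type*} [NormedAddCommGroup H] [InnerProductSpace ℂ H] [CompleteSpace H]
    (L0 : H →ₗ.[ℂ] H)
    (hdense : Dense (L0.domain : Set H))
    (hclosed : L0.IsClosed)
    (hsym : ∀ u v : L0.domain, ⟪L0 u, (v : H)⟫ = ⟪(u : H), L0 v⟫)
    (κ : ℝ) (hκ : 0 < κ)
    (hpos : ∀ y : L0.domain, κ * ‖(y : H)‖ ^ 2 ≤ (⟪L0 y, (y : H)⟫).re)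
    -- `L` is a self-adjoint extension of `L0`, positive definite, bijective onto `H`
    (L : H →ₗ.[ℂ] H) (hL0L : L0 ≤ L) (hLsa : L.adjoint = L)
    (hLpos : ∀ y : L.domain, κ * ‖(y : H)‖ ^ 2 ≤ (⟪L y, (y : H)⟫).re)
    -- `Linv` is the (bounded, everywhere-defined, self-adjoint) inverse of `L`
    (Linv : H →L[ℂ] H) (hLinvsa : IsSelfAdjoint Linv)
    (hinvl : ∀ x : L.domain, Linv (L x) = (x : H))
    (hinvmem : ∀ x : H, Linv x ∈ L.domain)
    (hinvr : ∀ x : H, L ⟨Linv x, hinvmem x⟩ = x)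
    -- `P` is the orthogonal projection of `H` onto `K = Ker L0*`
    (P : H →L[ℂ] H)
    (hPmem : ∀ x : H, P x ∈ pker L0.adjoint)
    (hPorth : ∀ x : H, x - P x ∈ (pker L0.adjoint)ᗮ) :
    ∀ y : L0.adjoint.domain,
      Linv (L0.adjoint y - P (L0.adjoint y)) ∈ L0.domain ∧
      P (L0.adjoint y) ∈ pker L0.adjoint ∧
      (y : H) - Linv (L0.adjoint y) ∈ pker L0.adjoint ∧
      (y : H) = Linv (L0.adjoint y - P (L0.adjoint y)) + Linv (P (L0.adjoint y))
        + ((y : H) - Linv (L0.adjoint y)) := by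
  have hinv0 : ∀ u : L0.domain, Linv (L0 u) = u := fun u => by
    rw [hL0L.2 (y := ⟨u, hL0L.1 u.2⟩) rfl, hinvl]
  intro y
  refine ⟨leftInverse_mem_domain_of_mem_pker_adjoint_orthogonal hdense hclosed hinv0 (hPorth _),
    hPmem _, mem_pker_adjoint_of_inner_eq_zero hdense fun u => ?_, ?_⟩
  · have hsa : ⟪Linv (L0.adjoint y), L0 u⟫ = ⟪L0.adjoint y, Linv (L0 u)⟫ :=
      hLinvsa.isSymmetric _ _
    rw [inner_sub_left, hsa, hinv0, LinearPMap.adjoint_isFormalAdjoint hdense y u, sub_self]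
  · rw [map_sub]
    abel
end

section
/- Under the same hypotheses (L0 closed densely defined symmetric positive definite, L a positive definite self-adjoint extension with bounded everywhere-defined inverse L⁻¹, K := Ker L0*), the Vishik decomposition is direct: if y0 ∈ Dom L0, g ∈ K, h ∈ K and y0 + L⁻¹ g + h = 0, then y0 = 0, g = 0 and h = 0. -/
local notation "⟪" x ", " y "⟫" => @inner ℂ _ _ x y

/-- The kernel of the adjoint is orthogonal to the range. -/
lemma inner_apply_eq_zero_of_mem_pker_adjoint {H : Type*} [NormedAddCommGroup H]
    [InnerProductSpace ℂ H] [CompleteSpace H] {T : H →ₗ.[ℂ] H}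
    (hT : Dense (T.domain : Set H)) {k : H} (hk : k ∈ pker T.adjoint) (u : T.domain) :
    ⟪k, T u⟫ = 0 := by
  obtain ⟨k, hk, rfl⟩ := hk
  have hk0 : T.adjoint k = 0 := hk
  simpa [hk0] using (T.adjoint_isFormalAdjoint hT k u).symm

/-- The Vishik decomposition is direct. -/
theorem statement2 {H : Type*} [NormedAddCommGroup H] [InnerProductSpace ℂ H] [CompleteSpace H]
    (L0 : H →ₗ.[ℂ] H)
    (hdense : Dense (L0.domain : Set H))
    (hclosed : L0.IsClosed)
    (hsym : ∀ u v : L0.domain, ⟪L0 u, (v : H)⟫ = ⟪(u : H), L0 v⟫)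
    (κ : ℝ) (hκ : 0 < κ)
    (hpos : ∀ y : L0.domain, κ * ‖(y : H)‖ ^ 2 ≤ (⟪L0 y, (y : H)⟫).re)
    -- `L` is a self-adjoint extension of `L0`, positive definite, bijective onto `H`
    (L : H →ₗ.[ℂ] H) (hL0L : L0 ≤ L) (hLsa : L.adjoint = L)
    (hLpos : ∀ y : L.domain, κ * ‖(y : H)‖ ^ 2 ≤ (⟪L y, (y : H)⟫).re)
    -- `Linv` is the (bounded, everywhere-defined, self-adjoint) inverse of `L`
    (Linv : H →L[ℂ] H) (hLinvsa : IsSelfAdjoint Linv)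
    (hinvl : ∀ x : L.domain, Linv (L x) = (x : H))
    (hinvmem : ∀ x : H, Linv x ∈ L.domain)
    (hinvr : ∀ x : H, L ⟨Linv x, hinvmem x⟩ = x)
    :
    ∀ (y0 : L0.domain) (g h : H), g ∈ pker L0.adjoint → h ∈ pker L0.adjoint →
      (y0 : H) + Linv g + h = 0 → (y0 : H) = 0 ∧ g = 0 ∧ h = 0 := by
  intro y0 g h hg hh hsum
  have hLinv (u : L0.domain) : Linv (L0 u) = u := by
    rw [hL0L.2 (y := ⟨u, hL0L.1 u.2⟩) rfl, hinvl]
  have hg_eq : L0 y0 + g = 0 := by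
    refine hdense.eq_zero_of_inner_left ℂ fun u hu => ?_
    have hgu : ⟪Linv g, L0 ⟨u, hu⟩⟫ = ⟪g, u⟫ := by
      simpa [hLinv] using hLinvsa.isSymmetric g (L0 ⟨u, hu⟩)
    have hzero : ⟪(y0 : H) + Linv g + h, L0 ⟨u, hu⟩⟫ = 0 := by rw [hsum, inner_zero_left]
    rwa [inner_add_left, inner_add_left, ← hsym, hgu,
      inner_apply_eq_zero_of_mem_pker_adjoint hdense hh, add_zero, ← inner_add_left] at hzero
  have hg0 : g = 0 := by
    have horth := inner_apply_eq_zero_of_mem_pker_adjoint hdense hg y0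
    rwa [eq_neg_of_add_eq_zero_left hg_eq, inner_neg_right, neg_eq_zero,
      inner_self_eq_zero] at horth
  have hy0 : (y0 : H) = 0 := by
    rw [← hLinv, eq_neg_of_add_eq_zero_left hg_eq, hg0, neg_zero, map_zero]
  exact ⟨hy0, hg0, by simpa [hy0, hg0] using hsum⟩
end

section
/- Let L0 be a closed densely defined symmetric positive definite operator in a complex Hilbert space H, K := Ker L0*, and P the orthogonal projection of H onto K. Let L be a positive definite self-adjoint extension of L0 with bounded everywhere-defined inverse L⁻¹. Then the boundary operator Γ2 y := P(L0* y) maps Dom L0* onto K: {P(L0* y) | y ∈ Dom L0*} = K. In particular, the closure of Ran Γ2 equals K. -/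
local notation "⟪" x ", " y "⟫" => @inner ℂ _ _ x y

/-- An everywhere-defined symmetric left inverse of an extension of `T` is a right inverse of the
adjoint of `T`. -/
theorem exists_adjoint_apply_eq_of_leftInverse {H : Type*} [NormedAddCommGroup H]
    [InnerProductSpace ℂ H] [CompleteSpace H] {T S : H →ₗ.[ℂ] H}
    (hT : Dense (T.domain : Set H)) (hTS : T ≤ S) {R : H →L[ℂ] H} (hR : IsSelfAdjoint R)
    (hRS : ∀ x : S.domain, R (S x) = (x : H)) (k : H) :
    ∃ y : T.adjoint.domain, T.adjoint y = k := by
  have h : ∀ x : T.domain, ⟪k, (x : H)⟫ = ⟪R k, T x⟫ := fun x => by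
    have hTx : T x = S ⟨x, hTS.1 x.2⟩ := hTS.2 rfl
    have hsymm : ⟪R k, T x⟫ = ⟪k, R (T x)⟫ := hR.isSymmetric k (T x)
    rw [hsymm, hTx, hRS]
  exact ⟨⟨R k, T.mem_adjoint_domain_of_exists _ ⟨k, h⟩⟩, LinearPMap.adjoint_apply_eq hT _ h⟩

/-- A map sending each point to its orthogonal projection onto `K` fixes exactly the points
of `K`. -/
theorem apply_eq_self_iff_mem_of_sub_mem_orthogonal {H : Type*} [NormedAddCommGroup H]
    [InnerProductSpace ℂ H] {K : Submodule ℂ H} {P : H → H} (hmem : ∀ x, P x ∈ K)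
    (horth : ∀ x, x - P x ∈ Kᗮ) {x : H} : P x = x ↔ x ∈ K := by
  refine ⟨fun h => h ▸ hmem x, fun hx => ?_⟩
  have h : x - P x ∈ K ⊓ Kᗮ := ⟨K.sub_mem hx (hmem x), horth x⟩
  rw [K.inf_orthogonal_eq_bot, Submodule.mem_bot, sub_eq_zero] at h
  exact h.symm

/-- The boundary operator `Γ2 = P L0*` maps `Dom L0*` onto `K = Ker L0*`. -/
theorem statement6 {H : Type*} [NormedAddCommGroup H] [InnerProductSpace ℂ H] [CompleteSpace H]
    (L0 : H →ₗ.[ℂ] H)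
    (hdense : Dense (L0.domain : Set H))
    (hclosed : L0.IsClosed)
    (hsym : ∀ u v : L0.domain, ⟪L0 u, (v : H)⟫ = ⟪(u : H), L0 v⟫)
    (κ : ℝ) (hκ : 0 < κ)
    (hpos : ∀ y : L0.domain, κ * ‖(y : H)‖ ^ 2 ≤ (⟪L0 y, (y : H)⟫).re)
    -- `L` is a self-adjoint extension of `L0`, positive definite, bijective onto `H`
    (L : H →ₗ.[ℂ] H) (hL0L : L0 ≤ L) (hLsa : L.adjoint = L)
    (hLpos : ∀ y : L.domain, κ * ‖(y : H)‖ ^ 2 ≤ (⟪L y, (y : H)⟫).re)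
    -- `Linv` is the (bounded, everywhere-defined, self-adjoint) inverse of `L`
    (Linv : H →L[ℂ] H) (hLinvsa : IsSelfAdjoint Linv)
    (hinvl : ∀ x : L.domain, Linv (L x) = (x : H))
    (hinvmem : ∀ x : H, Linv x ∈ L.domain)
    (hinvr : ∀ x : H, L ⟨Linv x, hinvmem x⟩ = x)
    -- `P` is the orthogonal projection of `H` onto `K = Ker L0*`
    (P : H →L[ℂ] H)
    (hPmem : ∀ x : H, P x ∈ pker L0.adjoint)
    (hPorth : ∀ x : H, x - P x ∈ (pker L0.adjoint)ᗮ) :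
    Set.range (fun y : L0.adjoint.domain => P (L0.adjoint y)) = (pker L0.adjoint : Set H) ∧
    closure (Set.range (fun y : L0.adjoint.domain => P (L0.adjoint y)))
      = (pker L0.adjoint : Set H) := by
  have hfix : ∀ {x : H}, P x = x ↔ x ∈ pker L0.adjoint :=
    apply_eq_self_iff_mem_of_sub_mem_orthogonal hPmem hPorth
  have hrange : Set.range (fun y : L0.adjoint.domain => P (L0.adjoint y)) =
      (pker L0.adjoint : Set H) := by
    refine Set.Subset.antisymm (Set.range_subset_iff.2 fun y => hPmem _) fun k hk => ?_
    obtain ⟨y, hy⟩ := exists_adjoint_apply_eq_of_leftInverse hdense hL0L hLinvsa hinvl k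
    exact ⟨y, by simpa only [hy] using hfix.2 hk⟩
  have hKclosed : IsClosed (pker L0.adjoint : Set H) := by
    have hK : (pker L0.adjoint : Set H) = {x | P x = x} := Set.ext fun _ => hfix.symm
    rw [hK]
    exact isClosed_eq P.continuous continuous_id
  exact ⟨hrange, by rw [hrange, hKclosed.closure_eq]⟩
end

section
/- Let L0 be a closed densely defined symmetric positive definite operator in a complex Hilbert space H. Suppose L0 has a self-adjoint part in a nonzero closed subspace N of H, i.e.: N ∩ Dom L0 is dense in N, L0 maps N ∩ Dom L0 into N, and the restriction of L0 to N ∩ Dom L0, regarded as a densely defined operator in the Hilbert space N, is self-adjoint. Then Ker L0* is orthogonal to N: Ker L0* ⊆ Nᗮ. -/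
local notation "⟪" x ", " y "⟫" => @inner ℂ _ _ x y

variable {H : Type*} [NormedAddCommGroup H] [InnerProductSpace ℂ H]


/-- The domain of the part of `L0` in a subspace `N`:
elements of `N` that lie in `Dom L0` and are mapped by `L0` into `N`. -/
def partDomain (L0 : H →ₗ.[ℂ] H) (N : Submodule ℂ H) : Submodule ℂ N where
  carrier := {x : N | ∃ hx : (x : H) ∈ L0.domain, L0 ⟨(x : H), hx⟩ ∈ N}
  zero_mem' := by
    refine ⟨L0.domain.zero_mem, ?_⟩
    have h0 : (⟨((0 : N) : H), L0.domain.zero_mem⟩ : L0.domain) = 0 := by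
      ext; rfl
    rw [h0, L0.map_zero]
    exact N.zero_mem
  add_mem' := by
    rintro x y ⟨hx, hLx⟩ ⟨hy, hLy⟩
    refine ⟨L0.domain.add_mem hx hy, ?_⟩
    have h : (⟨(((x + y : N)) : H), L0.domain.add_mem hx hy⟩ : L0.domain)
        = ⟨(x : H), hx⟩ + ⟨(y : H), hy⟩ := by ext; rfl
    rw [h, L0.map_add]
    exact N.add_mem hLx hLy
  smul_mem' := by
    rintro c x ⟨hx, hLx⟩
    refine ⟨L0.domain.smul_mem c hx, ?_⟩
    have h : (⟨(((c • x : N)) : H), L0.domain.smul_mem c hx⟩ : L0.domain)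
        = c • (⟨(x : H), hx⟩ : L0.domain) := by ext; rfl
    rw [h, L0.map_smul]
    exact N.smul_mem c hLx

/-- The part of `L0` in a subspace `N`, as a partially defined operator in `N`. -/
noncomputable def restrictPart (L0 : H →ₗ.[ℂ] H) (N : Submodule ℂ H) : N →ₗ.[ℂ] N where
  domain := partDomain L0 N
  toFun :=
    { toFun := fun x => ⟨L0 ⟨((x : N) : H), x.2.choose⟩, x.2.choose_spec⟩
      map_add' := by
        rintro x y
        ext
        show (L0 _ : H) = ((⟨L0 ⟨((x : N) : H), x.2.choose⟩, x.2.choose_spec⟩ : N)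
          + (⟨L0 ⟨((y : N) : H), y.2.choose⟩, y.2.choose_spec⟩ : N) : H)
        have h : (⟨(((x + y : ↥(partDomain L0 N)) : N) : H), (x + y).2.choose⟩ : L0.domain)
            = ⟨((x : N) : H), x.2.choose⟩ + ⟨((y : N) : H), y.2.choose⟩ := by
          ext; rfl
        rw [h, L0.map_add]
      map_smul' := by
        rintro c x
        ext
        show (L0 _ : H) = (c • (⟨L0 ⟨((x : N) : H), x.2.choose⟩, x.2.choose_spec⟩ : N) : H)
        have h : (⟨(((c • x : ↥(partDomain L0 N)) : N) : H), (c • x).2.choose⟩ : L0.domain)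
            = c • (⟨((x : N) : H), x.2.choose⟩ : L0.domain) := by
          ext; rfl
        rw [h, L0.map_smul] }

/-- If `L0` has a self-adjoint part in a nonzero closed subspace `N`,
then `Ker L0*` is orthogonal to `N`. -/
theorem statement8 {H : Type*} [NormedAddCommGroup H] [InnerProductSpace ℂ H] [CompleteSpace H]
    (L0 : H →ₗ.[ℂ] H)
    (hdense : Dense (L0.domain : Set H))
    (hclosed : L0.IsClosed)
    (hsym : ∀ u v : L0.domain, ⟪L0 u, (v : H)⟫ = ⟪(u : H), L0 v⟫)
    (κ : ℝ) (hκ : 0 < κ)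
    (hpos : ∀ y : L0.domain, κ * ‖(y : H)‖ ^ 2 ≤ (⟪L0 y, (y : H)⟫).re)
    -- `N` is a nonzero closed subspace of `H`
    (N : Submodule ℂ H) [CompleteSpace N] (hN : N ≠ ⊥)
    -- `N ∩ Dom L0` is dense in `N`
    (hdenseN : Dense {x : N | (x : H) ∈ L0.domain})
    -- `L0` maps `N ∩ Dom L0` into `N`
    (hmap : ∀ x : L0.domain, (x : H) ∈ N → L0 x ∈ N)
    -- the restriction of `L0` to `N ∩ Dom L0` is self-adjoint as an operator in `N`
    (hsaN : (restrictPart L0 N).adjoint = restrictPart L0 N) :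
    pker L0.adjoint ≤ Nᗮ := by
  rintro _ ⟨y, hy, rfl⟩
  have hzero : L0.adjoint y = 0 := hy
  have hdom : Dense ((restrictPart L0 N).domain : Set N) :=
    hdenseN.mono fun x hx => ⟨hx, hmap ⟨x, hx⟩ x.2⟩
  set p : N := N.orthogonalProjectionOnto (y : H)
  have hp : ∀ x : (restrictPart L0 N).domain, ⟪(0 : N), (x : N)⟫ = ⟪p, restrictPart L0 N x⟫ := by
    intro x
    have h := LinearPMap.adjoint_isFormalAdjoint hdense y ⟨((x : N) : H), x.2.choose⟩
    rw [hzero, inner_zero_left] at h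
    rw [inner_zero_left, Submodule.inner_orthogonalProjectionOnto_eq_of_mem_right]
    exact h
  have hpadj : p ∈ (restrictPart L0 N).adjoint.domain :=
    LinearPMap.mem_adjoint_domain_of_exists _ ⟨0, hp⟩
  have hApadj : (restrictPart L0 N).adjoint ⟨p, hpadj⟩ = 0 :=
    LinearPMap.adjoint_apply_eq hdom ⟨p, hpadj⟩ hp
  have hpdom : p ∈ (restrictPart L0 N).domain := by rwa [hsaN] at hpadj
  have hAp : restrictPart L0 N ⟨p, hpdom⟩ = 0 := by
    rw [← hApadj]
    exact ((LinearPMap.ext_iff.1 hsaN).2 (x := p) (hf := hpadj) (hg := hpdom)).symm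
  have hLp : L0 ⟨(p : H), hpdom.choose⟩ = 0 := congrArg Subtype.val hAp
  have hle := hpos ⟨(p : H), hpdom.choose⟩
  rw [hLp, inner_zero_left, Complex.zero_re] at hle
  have hsq : ‖(p : H)‖ ^ 2 ≤ 0 := nonpos_of_mul_nonpos_right hle hκ
  have hp0 : p = 0 := by
    ext
    exact norm_eq_zero.1 (pow_eq_zero_iff two_ne_zero |>.1 (le_antisymm hsq (sq_nonneg _)))
  exact Submodule.orthogonalProjectionOnto_eq_zero_iff.1 hp0
end

section
/- Let L0 be a closed densely defined symmetric positive definite operator in a complex Hilbert space H, and L a positive definite self-adjoint extension of L0 with bounded everywhere-defined inverse L⁻¹. Suppose L0 has a self-adjoint part in a nonzero closed subspace N of H (N ∩ Dom L0 dense in N, L0(N ∩ Dom L0) ⊆ N, and the restriction of L0 to N ∩ Dom L0 is self-adjoint as an operator in N). Then L⁻¹ is reduced by N: L⁻¹ N ⊆ N and L⁻¹ Nᗮ ⊆ Nᗮ. -/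
local notation "⟪" x ", " y "⟫" => @inner ℂ _ _ x y

variable {H : Type*} [NormedAddCommGroup H] [InnerProductSpace ℂ H]


/-- If `L0` has a self-adjoint part in a nonzero closed subspace `N`,
then the inverse of the Friedrichs-type extension `L` is reduced by `N`. -/
theorem statement9 {H : Type*} [NormedAddCommGroup H] [InnerProductSpace ℂ H] [CompleteSpace H]
    (L0 : H →ₗ.[ℂ] H)
    (hdense : Dense (L0.domain : Set H))
    (hclosed : L0.IsClosed)
    (hsym : ∀ u v : L0.domain, ⟪L0 u, (v : H)⟫ = ⟪(u : H), L0 v⟫)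
    (κ : ℝ) (hκ : 0 < κ)
    (hpos : ∀ y : L0.domain, κ * ‖(y : H)‖ ^ 2 ≤ (⟪L0 y, (y : H)⟫).re)
    -- `L` is a self-adjoint extension of `L0`, positive definite, bijective onto `H`
    (L : H →ₗ.[ℂ] H) (hL0L : L0 ≤ L) (hLsa : L.adjoint = L)
    (hLpos : ∀ y : L.domain, κ * ‖(y : H)‖ ^ 2 ≤ (⟪L y, (y : H)⟫).re)
    -- `Linv` is the (bounded, everywhere-defined, self-adjoint) inverse of `L`
    (Linv : H →L[ℂ] H) (hLinvsa : IsSelfAdjoint Linv)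
    (hinvl : ∀ x : L.domain, Linv (L x) = (x : H))
    (hinvmem : ∀ x : H, Linv x ∈ L.domain)
    (hinvr : ∀ x : H, L ⟨Linv x, hinvmem x⟩ = x)
    -- `N` is a nonzero closed subspace of `H`
    (N : Submodule ℂ H) [CompleteSpace N] (hN : N ≠ ⊥)
    -- `N ∩ Dom L0` is dense in `N`
    (hdenseN : Dense {x : N | (x : H) ∈ L0.domain})
    -- `L0` maps `N ∩ Dom L0` into `N`
    (hmap : ∀ x : L0.domain, (x : H) ∈ N → L0 x ∈ N)
    -- the restriction of `L0` to `N ∩ Dom L0` is self-adjoint as an operator in `N`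
    (hsaN : (restrictPart L0 N).adjoint = restrictPart L0 N) :
    (∀ x ∈ N, Linv x ∈ N) ∧ (∀ x ∈ Nᗮ, Linv x ∈ Nᗮ) := by
  have hLinv_symm : ∀ x y : H, ⟪Linv x, y⟫ = ⟪x, Linv y⟫ :=
    ContinuousLinearMap.isSelfAdjoint_iff_isSymmetric.mp hLinvsa
  have hinvL0 : ∀ z : L0.domain, Linv (L0 z) = (z : H) := fun z => by
    rw [hL0L.2 (y := ⟨z, hL0L.1 z.2⟩) rfl, hinvl]
  have hdensePart : Dense ((restrictPart L0 N).domain : Set N) :=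
    hdenseN.mono fun x hx => ⟨hx, hmap ⟨x, hx⟩ x.2⟩
  have hinvN : ∀ x ∈ N, Linv x ∈ N := by
    intro x hx
    -- the orthogonal projection `y` of `Linv x` onto `N` lies in the domain of the adjoint
    -- of the part of `L0` in `N`, which sends it to `x`
    set y : N := N.orthogonalProjectionOnto (Linv x)
    have hy : ∀ z : (restrictPart L0 N).domain,
        ⟪(⟨x, hx⟩ : N), (z : N)⟫ = ⟪y, restrictPart L0 N z⟫ := by
      intro z
      rw [Submodule.inner_orthogonalProjectionOnto_eq_of_mem_right]
      change ⟪x, ((z : N) : H)⟫ = ⟪Linv x, L0 ⟨((z : N) : H), z.2.choose⟩⟫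
      rw [hLinv_symm, hinvL0]
    have hmem : y ∈ (restrictPart L0 N).adjoint.domain :=
      LinearPMap.mem_adjoint_domain_of_exists _ ⟨_, hy⟩
    have hval := LinearPMap.adjoint_apply_eq hdensePart ⟨y, hmem⟩ hy
    have hmem' : y ∈ (restrictPart L0 N).domain := hsaN ▸ hmem
    rw [hsaN.le.2 (y := ⟨y, hmem'⟩) rfl] at hval
    have hL0y : L0 ⟨(y : H), hmem'.choose⟩ = x := congrArg Subtype.val hval
    rw [← hL0y, hinvL0]
    exact y.2
  constructor
  · exact hinvN
  · intro x hx
    rw [Submodule.mem_orthogonal] at hx ⊢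
    intro u hu
    rw [← hLinv_symm u x]
    exact hx _ (hinvN u hu)
end

section
/- (Lemma 3, abstract form.) Let α be a partially ordered set with a least element ⊥, and let Ω be a set of functions a from the positive reals to α such that every a ∈ Ω is monotone (s ≤ t implies a(s) ≤ a(t)) and not identically ⊥ (there exists t > 0 with a(t) ≠ ⊥). For a ∈ Ω and r > 0 define the ball B_r[a] := {b ∈ Ω | ∃ t > 0, b(t) ≠ ⊥ and b(t) ≤ a(r)}. Then the system of balls {B_r[a] | a ∈ Ω, r > 0} is a base of a topology on Ω; that is: (i) every a ∈ Ω is contained in some ball, and (ii) for every a ∈ Ω and balls B_{r1}[a1], B_{r2}[a2] with a ∈ B_{r1}[a1] ∩ B_{r2}[a2], there exists r > 0 such that a ∈ B_r[a] ⊆ B_{r1}[a1] ∩ B_{r2}[a2]. Consequently the collection of balls is a topological basis (TopologicalSpace.IsTopologicalBasis) of the topology it generates on Ω. -/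
/-- The ball with center a function `c` and radius `r`, inside a set `Ω` of
functions from positive reals to a partially ordered set with least element. -/
def ball {α : Type*} [PartialOrder α] [OrderBot α]
    (Ω : Set ({t : ℝ // 0 < t} → α)) (c : {t : ℝ // 0 < t} → α) (r : {t : ℝ // 0 < t}) :
    Set Ω :=
  {b | ∃ t : {t : ℝ // 0 < t}, (b : {t : ℝ // 0 < t} → α) t ≠ ⊥ ∧
    (b : {t : ℝ // 0 < t} → α) t ≤ c r}

/-- Lemma 3 (abstract form): the system of balls is a base of a topology. -/
theorem statement13 {α : Type*} [PartialOrder α] [OrderBot α]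
    (Ω : Set ({t : ℝ // 0 < t} → α))
    (hmono : ∀ a ∈ Ω, Monotone a)
    (hnontriv : ∀ a ∈ Ω, ∃ t : {t : ℝ // 0 < t}, a t ≠ ⊥) :
    -- (i) every element of `Ω` belongs to some ball
    (∀ a : Ω, ∃ c ∈ Ω, ∃ r : {t : ℝ // 0 < t}, a ∈ ball Ω c r) ∧
    -- (ii) for `a` in the intersection of two balls there is a ball centered at `a`,
    -- containing `a` and contained in the intersection
    (∀ (a : Ω) (a1 a2 : {t : ℝ // 0 < t} → α), a1 ∈ Ω → a2 ∈ Ω →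
      ∀ r1 r2 : {t : ℝ // 0 < t}, a ∈ ball Ω a1 r1 ∩ ball Ω a2 r2 →
        ∃ r : {t : ℝ // 0 < t}, a ∈ ball Ω (a : {t : ℝ // 0 < t} → α) r ∧
          ball Ω (a : {t : ℝ // 0 < t} → α) r ⊆ ball Ω a1 r1 ∩ ball Ω a2 r2) ∧
    -- consequently, the collection of balls is a topological basis of the
    -- topology it generates on `Ω`
    @TopologicalSpace.IsTopologicalBasis Ω
      (TopologicalSpace.generateFrom
        {s : Set Ω | ∃ c ∈ Ω, ∃ r : {t : ℝ // 0 < t}, s = ball Ω c r})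
      {s : Set Ω | ∃ c ∈ Ω, ∃ r : {t : ℝ // 0 < t}, s = ball Ω c r} := by
  have hcover : ∀ a : Ω, ∃ c ∈ Ω, ∃ r : {t : ℝ // 0 < t}, a ∈ ball Ω c r := by
    intro a
    obtain ⟨t, ht⟩ := hnontriv a a.2
    exact ⟨a, a.2, t, t, ht, le_rfl⟩
  have hinter : ∀ (a : Ω) (a1 a2 : {t : ℝ // 0 < t} → α), a1 ∈ Ω → a2 ∈ Ω →
      ∀ r1 r2 : {t : ℝ // 0 < t}, a ∈ ball Ω a1 r1 ∩ ball Ω a2 r2 →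
        ∃ r : {t : ℝ // 0 < t}, a ∈ ball Ω (a : {t : ℝ // 0 < t} → α) r ∧
          ball Ω (a : {t : ℝ // 0 < t} → α) r ⊆ ball Ω a1 r1 ∩ ball Ω a2 r2 := by
    rintro a a1 a2 - - r1 r2 ⟨⟨t1, hne1, hle1⟩, ⟨t2, hne2, hle2⟩⟩
    have hne : (a : {t : ℝ // 0 < t} → α) (min t1 t2) ≠ ⊥ := by
      rcases min_choice t1 t2 with h | h <;> rw [h] <;> assumption
    refine ⟨min t1 t2, ⟨min t1 t2, hne, le_rfl⟩, ?_⟩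
    rintro b ⟨t, hbt, hle⟩
    exact ⟨⟨t, hbt, hle.trans ((hmono a a.2 (min_le_left t1 t2)).trans hle1)⟩,
      ⟨t, hbt, hle.trans ((hmono a a.2 (min_le_right t1 t2)).trans hle2)⟩⟩
  refine ⟨hcover, hinter, ?_⟩
  refine @TopologicalSpace.IsTopologicalBasis.mk Ω (_) _ ?_ ?_ rfl
  · rintro _ ⟨a1, h1, r1, rfl⟩ _ ⟨a2, h2, r2, rfl⟩ a ha
    obtain ⟨r, har, hsub⟩ := hinter a a1 a2 h1 h2 r1 r2 ha
    exact ⟨_, ⟨a, a.2, r, rfl⟩, har, hsub⟩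
  · refine Set.eq_univ_of_forall fun a => ?_
    obtain ⟨c, hc, r, har⟩ := hcover a
    exact ⟨_, ⟨c, hc, r, rfl⟩, har⟩
end
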